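/- Let R be a principal ideal domain of characteristic 0, let G be a finite group, let U ≤ G be a subgroup, and let M be an R[G]-lattice. Then the following are equivalent: (i) H^1(U, Res^G_U(M^*)) = 0, where M^* = Hom_R(M,R) with the contragredient G-action; (ii) the Tate cohomology group Ĥ^{-1}(U, Res^G_U M) vanishes; (iii) the coinvariants M/ω_{R[U]}M are torsion free as an R-module. -/

import Mathlib

/-!
Definitions for `R[G]`-lattices and permutation lattices, following
Torrecillas–Weigel, "Lattices and cohomological Mackey functors for finite
cyclic p-groups".  An `R[G]`-module is encoded as an `R`-module `M` together
with a representation `ρ : Representation R G M`.  Proof obligations inside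
auxiliary definitions are `Prop`-valued and may be left as `sorry` without
affecting the meaning of the statements.
-/

set_option maxHeartbeats 1000000
set_option synthInstance.maxHeartbeats 400000

noncomputable section

namespace RepCore

variable {R : Type} [CommRing R] {G : Type} [Group G]
variable {M : Type} [AddCommGroup M] [Module R M]

/-- `M` (with `G` acting through `ρ`) is an `R[G]`-permutation module:
it is isomorphic to `R[Ω]` for some finite `G`-set `Ω` (a `G`-set being
given by a permutation action `a : G →* Equiv.Perm Ω`), with `G` acting by
permuting the basis. -/
def IsPermLattice (ρ : Representation R G M) : Prop :=
  ∃ (Ω : Type) (_ : Fintype Ω) (a : G →* Equiv.Perm Ω) (e : M ≃ₗ[R] (Ω →₀ R)),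
    ∀ (g : G) (m : M), e (ρ g m) = Finsupp.mapDomain (a g) (e m)

/-- The augmentation submodule `ω_{R[G]}·M ⊆ M`, i.e. the submodule
generated by all `g•m − m`.  The quotient `M ⧸ augSub ρ` is the module of
coinvariants `M_G`. -/
def augSub (ρ : Representation R G M) : Submodule R M :=
  Submodule.span R {x | ∃ (g : G) (m : M), x = ρ g m - m}

/-- Vanishing of the first group cohomology `H¹(G, M)`. -/
def H1Trivial (ρ : Representation R G M) : Prop :=
  Subsingleton (groupCohomology (Rep.of ρ) 1)

/-- The norm map `N_U = Σ_{u ∈ U} u·(−)` for a subgroup `U ≤ G`. -/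
def subNorm [Finite G] (ρ : Representation R G M) (U : Subgroup G) :
    M →ₗ[R] M := by
  classical
  have : Fintype ↥U := Fintype.ofFinite ↥U
  exact ∑ u : ↥U, ρ (u : G)

end RepCore

namespace RepCore

section

variable {R : Type} [CommRing R] {G : Type} [Group G]
variable {M : Type} [AddCommGroup M] [Module R M]

/-- `H¹` vanishes iff every crossed homomorphism is principal. -/
theorem h1Trivial_iff (σ : Representation R G M) :
    H1Trivial σ ↔ ∀ f : G → M, (∀ g h, f (g * h) = σ g (f h) + f g) →
      ∃ x, ∀ g, f g = σ g x - x := by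
  constructor
  · intro hs f hf
    have : Subsingleton (groupCohomology (Rep.of σ) 1) := hs
    have hz := (groupCohomology.H1π_eq_zero_iff (A := Rep.of σ)
      ⟨f, (groupCohomology.mem_cocycles₁_iff (A := Rep.of σ) f).2 hf⟩).1 (Subsingleton.elim _ _)
    obtain ⟨x, hx⟩ := hz
    exact ⟨x, fun g => (congrFun hx g).symm⟩
  · intro h
    refine subsingleton_of_forall_eq 0 fun y => ?_
    induction y using groupCohomology.H1_induction_on with
    | h f =>
      obtain ⟨x, hx⟩ := h f ((groupCohomology.mem_cocycles₁_iff (A := Rep.of σ) f).1 f.2)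
      exact (groupCohomology.H1π_eq_zero_iff f).2 ⟨x, funext fun g => (hx g).symm⟩

theorem sub_mem_augSub (σ : Representation R G M) (g : G) (m : M) : σ g m - m ∈ augSub σ :=
  Submodule.subset_span ⟨g, m, rfl⟩

theorem sum_apply_eq_zero_of_mem_augSub [Fintype G] (σ : Representation R G M) {m : M}
    (hm : m ∈ augSub σ) : ∑ g, σ g m = 0 := by
  have hle : augSub σ ≤ LinearMap.ker (∑ g, σ g) := by
    refine Submodule.span_le.2 ?_
    rintro _ ⟨h, m, rfl⟩
    have : ∑ g, σ g (σ h m) = ∑ g, σ g m := by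
      simpa [map_mul] using Equiv.sum_comp (Equiv.mulRight h) fun g => σ g m
    simp [this]
  simpa using hle hm

theorem sum_apply_sub_card_smul_mem_augSub [Fintype G] (σ : Representation R G M) (m : M) :
    (∑ g, σ g m) - (Fintype.card G : R) • m ∈ augSub σ := by
  have : (∑ g, σ g m) - (Fintype.card G : R) • m = ∑ g, (σ g m - m) := by
    simp [Finset.sum_sub_distrib, Nat.cast_smul_eq_nsmul]
  rw [this]
  exact Submodule.sum_mem _ fun g _ => sub_mem_augSub σ g m

/-- A linear form on a domain all of whose values are divisible by `n ≠ 0` is divisible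
by `n`. -/
theorem exists_smul_eq_of_forall_dvd [IsDomain R] {n : R} (hn : n ≠ 0) (l : M →ₗ[R] R)
    (h : ∀ m, n ∣ l m) : ∃ k : M →ₗ[R] R, ∀ m, l m = n * k m := by
  choose k hk using h
  exact ⟨{ toFun := k
           map_add' := fun x y => mul_left_cancel₀ hn <| by
             rw [mul_add, ← hk, ← hk, ← hk, map_add]
           map_smul' := fun r x => mul_left_cancel₀ hn <| by
             rw [← hk, map_smul, hk x, smul_eq_mul, RingHom.id_apply, smul_eq_mul,
               mul_left_comm] }, hk⟩

/-- The elements killed by the norm lie in the augmentation submodule iff the coinvariants are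
torsion free. -/
theorem ker_norm_le_augSub_iff [IsDomain R] [CharZero R] [Module.IsTorsionFree R M] [Fintype G]
    (σ : Representation R G M) :
    (∀ m, ∑ g, σ g m = 0 → m ∈ augSub σ) ↔
      ∀ (r : R) (m : M), r • m ∈ augSub σ → r = 0 ∨ m ∈ augSub σ := by
  constructor
  · intro h r m hrm
    refine or_iff_not_imp_left.2 fun hr => h m ?_
    have hz := sum_apply_eq_zero_of_mem_augSub σ hrm
    simp only [map_smul, ← Finset.smul_sum] at hz
    exact (smul_eq_zero.1 hz).resolve_left hr
  · intro h m hm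
    have hc := sum_apply_sub_card_smul_mem_augSub σ m
    rw [hm, zero_sub, neg_mem_iff] at hc
    exact (h _ m hc).resolve_left (Nat.cast_ne_zero.2 Fintype.card_ne_zero)

/-- If `H¹` of the dual vanishes, linear forms on the augmentation submodule extend. -/
theorem exists_extend_of_h1Trivial_dual (σ : Representation R G M) (h : H1Trivial σ.dual)
    (χ : augSub σ →ₗ[R] R) : ∃ ψ : M →ₗ[R] R, ∀ a : augSub σ, ψ a = χ a := by
  let d (g : G) : M →ₗ[R] augSub σ :=
    (σ g⁻¹ - LinearMap.id).codRestrict _ fun m => sub_mem_augSub σ g⁻¹ m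
  obtain ⟨ψ, hψ⟩ := (h1Trivial_iff σ.dual).1 h (fun g => χ ∘ₗ d g) fun g k => by
    refine LinearMap.ext fun m => ?_
    change χ (d (g * k) m) = χ (d k (σ g⁻¹ m)) + χ (d g m)
    rw [← map_add]
    congr 1
    ext
    simp [d, mul_inv_rev]
  have key : ∀ g m, χ (d g m) = ψ (σ g⁻¹ m) - ψ m := fun g m => LinearMap.congr_fun (hψ g) m
  refine ⟨ψ, fun ⟨a, ha⟩ => ?_⟩
  have hspan : ∀ x, ∀ hx : x ∈ augSub σ, ψ x = χ ⟨x, hx⟩ := by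
    intro x hx
    induction hx using Submodule.span_induction with
    | mem x hx' =>
      obtain ⟨g, m, rfl⟩ := hx'
      have := key g⁻¹ m
      rw [inv_inv] at this
      rw [map_sub, ← this]
      congr 1
      ext
      simp [d]
    | zero => exact (map_zero ψ).trans (map_zero χ).symm
    | add x y hx hy h₁ h₂ =>
      rw [map_add, h₁, h₂]
      exact (map_add χ ⟨x, hx⟩ ⟨y, hy⟩).symm
    | smul r x hx h₁ =>
      rw [map_smul, h₁]
      exact (map_smul χ r ⟨x, hx⟩).symm
  exact hspan a ha

/-- A submodule of a finite free module over a PID to whose ambient module every linear form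
extends is saturated. -/
theorem mem_of_smul_mem_of_forall_extend [IsDomain R] [IsPrincipalIdealRing R]
    [Module.Finite R M] [Module.IsTorsionFree R M] (A : Submodule R M)
    (h : ∀ χ : A →ₗ[R] R, ∃ ψ : M →ₗ[R] R, ∀ a : A, ψ a = χ a)
    {r : R} {m : M} (hr : r ≠ 0) (hm : r • m ∈ A) : m ∈ A := by
  let b := Module.Free.chooseBasis R A
  choose ψ hψ using fun i => h (b.coord i)
  let p : M →ₗ[R] A := ∑ i, (ψ i).smulRight (b i)
  have hp : p (r • m) = ⟨r • m, hm⟩ := by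
    have := b.sum_repr ⟨r • m, hm⟩
    simp only [← Module.Basis.coord_apply, ← hψ] at this
    simpa [p, Finset.smul_sum, smul_smul] using this
  have hsm : r • (p m : M) = r • m := by
    rw [map_smul] at hp
    exact congrArg Subtype.val hp
  rw [← smul_right_injective M hr hsm]
  exact (p m).2

/-- If the coinvariants are torsion free, `H¹` of the dual vanishes. -/
theorem h1Trivial_dual_of_saturated [IsDomain R] [IsPrincipalIdealRing R] [CharZero R]
    [Module.Finite R M] [Fintype G] (σ : Representation R G M)
    (h : ∀ (r : R) (m : M), r • m ∈ augSub σ → r = 0 ∨ m ∈ augSub σ) :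
    H1Trivial σ.dual := by
  refine (h1Trivial_iff σ.dual).2 fun f hf => ?_
  have hf' : ∀ g k m, f (g * k) m = f k (σ g⁻¹ m) + f g m :=
    fun g k m => LinearMap.congr_fun (hf g k) m
  have hn : (Fintype.card G : R) ≠ 0 := Nat.cast_ne_zero.2 Fintype.card_ne_zero
  let φ : M →ₗ[R] R := ∑ k, f k
  have hφ : ∀ g m, φ (σ g⁻¹ m - m) = (Fintype.card G : R) * (- f g m) := by
    intro g m
    have : ∑ k, f k m = ∑ k, f k (σ g⁻¹ m) + Fintype.card G * f g m := by
      rw [← Equiv.sum_comp (Equiv.mulLeft g)]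
      simp [hf', Finset.sum_add_distrib]
    simp only [φ, map_sub, LinearMap.sum_apply, this]
    ring
  have hdvd : ∀ a ∈ augSub σ, (Fintype.card G : R) ∣ φ a := by
    intro a ha
    induction ha using Submodule.span_induction with
    | mem x hx =>
      obtain ⟨g, m, rfl⟩ := hx
      have := hφ g⁻¹ m
      rw [inv_inv] at this
      exact ⟨_, this⟩
    | zero => simp
    | add x y _ _ hx hy => rw [map_add]; exact dvd_add hx hy
    | smul r x _ hx => rw [map_smul]; exact hx.mul_left r
  have : Module.IsTorsionFree R (M ⧸ augSub σ) := by
    refine Module.IsTorsionFree.of_smul_eq_zero fun r x hx => ?_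
    induction x using Submodule.Quotient.induction_on with
    | H m =>
      rw [← Submodule.Quotient.mk_smul, Submodule.Quotient.mk_eq_zero] at hx
      rw [Submodule.Quotient.mk_eq_zero]
      exact h r m hx
  obtain ⟨s, hs⟩ := Module.projective_lifting_property (augSub σ).mkQ LinearMap.id
    (augSub σ).mkQ_surjective
  let p : M →ₗ[R] M := LinearMap.id - s ∘ₗ (augSub σ).mkQ
  have hp : ∀ m, p m ∈ augSub σ := fun m => by
    rw [← Submodule.ker_mkQ (augSub σ), LinearMap.mem_ker]
    have := LinearMap.congr_fun hs ((augSub σ).mkQ m)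
    simp only [LinearMap.comp_apply, LinearMap.id_apply] at this
    simp [p, - Submodule.mkQ_apply, this]
  have hp' : ∀ a ∈ augSub σ, p a = a := fun a ha => by
    simp [p, (Submodule.Quotient.mk_eq_zero _).2 ha]
  obtain ⟨ψ, hψ⟩ := exists_smul_eq_of_forall_dvd hn (φ ∘ₗ p) fun m => hdvd _ (hp m)
  refine ⟨-ψ, fun g => LinearMap.ext fun m => ?_⟩
  change f g m = -ψ (σ g⁻¹ m) - -ψ m
  have h1 := hψ (σ g⁻¹ m - m)
  rw [LinearMap.comp_apply, hp' _ (sub_mem_augSub σ g⁻¹ m), hφ] at h1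
  have h2 := mul_left_cancel₀ hn h1
  rw [map_sub] at h2
  linear_combination -h2

/-- `H¹` of the dual of a lattice vanishes iff the coinvariants are torsion free. -/
theorem h1Trivial_dual_iff [IsDomain R] [IsPrincipalIdealRing R] [CharZero R]
    [Module.Finite R M] [Module.IsTorsionFree R M] [Fintype G] (σ : Representation R G M) :
    H1Trivial σ.dual ↔ ∀ (r : R) (m : M), r • m ∈ augSub σ → r = 0 ∨ m ∈ augSub σ :=
  ⟨fun h _ _ hm => or_iff_not_imp_left.2 fun hr =>
    mem_of_smul_mem_of_forall_extend _ (exists_extend_of_h1Trivial_dual σ h) hr hm,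
    h1Trivial_dual_of_saturated σ⟩

end

end RepCore

/-- Let `R` be a principal ideal domain of characteristic `0`, `G` a finite
group, `U ≤ G` and `M` an `R[G]`-lattice.  The following are equivalent:
(i) `H¹(U, Res^G_U (M^*)) = 0` (where `M^* = Hom_R(M,R)` with the
contragredient action);
(ii) `Ĥ^{-1}(U, Res^G_U M) = ker N_U / ω_{R[U]}M` vanishes;
(iii) the coinvariants `M/ω_{R[U]}M` are `R`-torsion free. -/
theorem dual_H1_tate_and_torsionfree_coinvariants
    (R : Type) [CommRing R] [IsDomain R] [IsPrincipalIdealRing R] [CharZero R]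
    (G : Type) [Group G] [Finite G] (U : Subgroup G)
    (M : Type) [AddCommGroup M] [Module R M]
    [Module.Finite R M] [Module.Projective R M]
    (ρ : Representation R G M) :
    (RepCore.H1Trivial ((ρ.dual).comp U.subtype) ↔
      ∀ m : M, RepCore.subNorm ρ U m = 0 →
        m ∈ RepCore.augSub (ρ.comp U.subtype)) ∧
    (RepCore.H1Trivial ((ρ.dual).comp U.subtype) ↔
      ∀ (r : R) (x : M ⧸ RepCore.augSub (ρ.comp U.subtype)),
        r • x = 0 → r = 0 ∨ x = 0) := by
  classical
  have : Fintype ↥U := Fintype.ofFinite ↥U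
  have : Module.IsTorsionFree R M := inferInstance
  have hN : ∀ m, RepCore.subNorm ρ U m = ∑ u, (ρ.comp U.subtype) u m := fun m => by
    rw [RepCore.subNorm, LinearMap.sum_apply]
    exact Finset.sum_congr (by ext; simp) fun _ _ => rfl
  have h₁ := RepCore.h1Trivial_dual_iff (ρ.comp U.subtype)
  have hdual : Representation.dual (ρ.comp U.subtype) = ρ.dual.comp U.subtype := rfl
  rw [hdual] at h₁
  refine ⟨?_, ?_⟩
  · simp only [hN]
    exact h₁.trans (RepCore.ker_norm_le_augSub_iff (ρ.comp U.subtype)).symm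
  · refine h₁.trans (forall_congr' fun r => ?_)
    rw [(Submodule.Quotient.mk_surjective _).forall]
    simp only [← Submodule.Quotient.mk_smul, Submodule.Quotient.mk_eq_zero]
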